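/- (Necessary condition for the Pólya–Szegő inequality, Euclidean version.) Let ·* be a transformation of Borel subsets of ℝ^n inducing a transformation of functions acting on level sets. Let φ, ψ : ℝ^n × ℝ^n → [0, +∞] be Borel measurable with φ(x, 0) = 0 and ψ(y, 0) = 0 for all x, y. Suppose that for every bounded Borel measurable u : ℝ^n → ℝ with u ∈ W^{1,1}_loc(ℝ^n) and ∫_{ℝ^n} φ(x, du(x)) dx < ∞, one has u* ∈ W^{1,1}_loc(ℝ^n) and ∫_{ℝ^n} ψ(y, du*(y)) dy ≤ ∫_{ℝ^n} φ(x, du(x)) dx. Then for every pair of Borel sets A ⊆ B ⊆ ℝ^n and every λ > 0, capa_{ψ,λ}(A*, B*) ≤ capa_{φ,λ}(A, B). -/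

import Mathlib

open MeasureTheory Set Filter Topology ENNReal

noncomputable section

abbrev En (n : ℕ) := EuclideanSpace ℝ (Fin n)

/-- `Du` is the weak gradient of `u` on `ℝⁿ`. -/
def HasWeakGradient {n : ℕ} (u : En n → ℝ) (Du : En n → En n) : Prop :=
  LocallyIntegrable u volume ∧ LocallyIntegrable Du volume ∧
    ∀ φ : En n → ℝ, ContDiff ℝ (⊤ : ℕ∞) φ → HasCompactSupport φ → ∀ i : Fin n,
      ∫ x, u x * fderiv ℝ φ x (EuclideanSpace.single i 1) = - ∫ x, Du x i * φ x

/-- The capacity `capa_{Φ,λ}(A,B)` associated to the integrand `Φ` and the level `λ`. -/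
def capaGen {n : ℕ} (Φ : En n → En n → ℝ≥0∞) (lam : ℝ) (A B : Set (En n)) : ℝ≥0∞ :=
  ⨅ (u : En n → ℝ) (Du : En n → En n) (_ : HasWeakGradient u Du)
    (_ : ∀ x ∈ A, u x = lam) (_ : ∀ x ∉ B, u x = 0), ∫⁻ x, Φ x (Du x)

/-- `Ψ` is locally coercive: `ψ(x,ξ)/‖ξ‖` tends to `∞` uniformly for `x` in a compact set. -/
def LocallyCoercive {n : ℕ} (Ψ : En n → En n → ℝ≥0∞) : Prop :=
  ∀ K : Set (En n), IsCompact K → ∀ C : ℝ, ∃ r : ℝ, ∀ x ∈ K, ∀ ξ : En n,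
    r ≤ ‖ξ‖ → ENNReal.ofReal (C * ‖ξ‖) ≤ Ψ x ξ

/-- A transformation of Borel sets of `ℝⁿ` inducing a transformation of Borel functions acting
on level sets. -/
structure SetRearrangement (n : ℕ) where
  setMap : Set (En n) → Set (En n)
  fnMap : (En n → EReal) → En n → EReal
  measurableSet_setMap : ∀ A : Set (En n), MeasurableSet A → MeasurableSet (setMap A)
  setMap_empty : setMap ∅ = ∅
  setMap_univ : setMap univ = univ
  measurable_fnMap : ∀ u : En n → EReal, Measurable u → Measurable (fnMap u)
  levelSet_fnMap : ∀ u : En n → EReal, Measurable u → ∀ t : ℝ,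
    {y | (t : EReal) < fnMap u y} = setMap {x | (t : EReal) < u x}

open scoped Convolution

/-- The mollification of `w` by the normalised bump function `ρ`. -/
def mollify {n : ℕ} (ρ : ContDiffBump (0 : En n)) (w : En n → ℝ) : En n → ℝ :=
  ρ.normed volume ⋆[ContinuousLinearMap.lsmul ℝ ℝ, volume] w

theorem mollify_apply {n : ℕ} (ρ : ContDiffBump (0 : En n)) (w : En n → ℝ) (x : En n) :
    mollify ρ w x = ∫ t, ρ.normed volume t * w (x - t) := rfl

theorem mollify_apply_swap {n : ℕ} (ρ : ContDiffBump (0 : En n)) (w : En n → ℝ) (x : En n) :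
    mollify ρ w x = ∫ t, ρ.normed volume (x - t) * w t :=
  convolution_eq_swap _

theorem integrable_mollify {n : ℕ} (ρ : ContDiffBump (0 : En n)) {w : En n → ℝ}
    (hw : Integrable w) : Integrable (mollify ρ w) :=
  ρ.integrable_normed.integrable_convolution _ hw

theorem integral_mollify {n : ℕ} (ρ : ContDiffBump (0 : En n)) {w : En n → ℝ}
    (hw : Integrable w) : ∫ x, mollify ρ w x = ∫ x, w x := by
  unfold mollify
  rw [integral_convolution _ ρ.integrable_normed hw, ρ.integral_normed]
  simp

theorem contDiff_mollify {n : ℕ} (ρ : ContDiffBump (0 : En n)) {w : En n → ℝ}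
    (hw : LocallyIntegrable w) : ContDiff ℝ 1 (mollify ρ w) :=
  ρ.hasCompactSupport_normed.contDiff_convolution_left _ (ρ.contDiff_normed (n := 1)) hw

theorem mollify_sub {n : ℕ} (ρ : ContDiffBump (0 : En n)) {v w : En n → ℝ}
    (hv : LocallyIntegrable v) (hw : LocallyIntegrable w) (x : En n) :
    mollify ρ (fun y => v y - w y) x = mollify ρ v x - mollify ρ w x := by
  have h : ∀ {w : En n → ℝ}, LocallyIntegrable w →
      Integrable (fun t => ρ.normed volume t * w (x - t)) := fun hw =>
    (ρ.hasCompactSupport_normed.convolutionExists_left (ContinuousLinearMap.lsmul ℝ ℝ)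
      ρ.continuous_normed hw) x
  simp only [mollify_apply, mul_sub]
  exact integral_sub (h hv) (h hw)

theorem mollify_congr_of_eqOn_ball {n : ℕ} (ρ : ContDiffBump (0 : En n)) {v w : En n → ℝ}
    {x : En n} (h : ∀ y ∈ Metric.ball x ρ.rOut, v y = w y) :
    mollify ρ v x = mollify ρ w x := by
  simp only [mollify_apply]
  refine integral_congr_ae (.of_forall fun t => ?_)
  by_cases ht : t ∈ Metric.ball (0 : En n) ρ.rOut
  · have : x - t ∈ Metric.ball x ρ.rOut := by simpa [dist_eq_norm] using ht
    simp [h _ this]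
  · rw [← ρ.support_normed_eq (μ := volume), Function.notMem_support] at ht
    simp [ht]

/-- **Scheffé's lemma** for nonnegative functions. -/
theorem tendsto_integral_abs_sub_of_nonneg {α : Type*} [MeasurableSpace α] {μ : Measure α}
    {F : ℕ → α → ℝ} {f : α → ℝ} (hF : ∀ j, Integrable (F j) μ) (hf : Integrable f μ)
    (hF0 : ∀ j x, 0 ≤ F j x) (hf0 : ∀ x, 0 ≤ f x)
    (hint : ∀ j, ∫ x, F j x ∂μ = ∫ x, f x ∂μ)
    (hlim : ∀ᵐ x ∂μ, Tendsto (fun j => F j x) atTop (𝓝 (f x))) :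
    Tendsto (fun j => ∫ x, |F j x - f x| ∂μ) atTop (𝓝 0) := by
  have key : ∀ j, ∫ x, |F j x - f x| ∂μ = 2 * ∫ x, max (f x - F j x) 0 ∂μ := by
    intro j
    have h1 : ∀ x, |F j x - f x| = (F j x - f x) + 2 * max (f x - F j x) 0 := by
      intro x
      rcases le_total (F j x) (f x) with h | h
      · rw [abs_of_nonpos (by linarith), max_eq_left (by linarith)]; ring
      · rw [abs_of_nonneg (by linarith), max_eq_right (by linarith)]; ring
    simp only [h1]
    have i1 : Integrable (fun x => F j x - f x) μ := (hF j).sub hf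
    have i2 : Integrable (fun x => 2 * max (f x - F j x) 0) μ :=
      (hf.sub (hF j)).pos_part.const_mul 2
    rw [integral_add i1 i2, integral_sub (hF j) hf, hint j, sub_self, zero_add,
      integral_const_mul]
  simp only [key]
  have h0 : Tendsto (fun j => ∫ x, max (f x - F j x) 0 ∂μ) atTop (𝓝 (∫ _, (0 : ℝ) ∂μ)) := by
    refine tendsto_integral_of_dominated_convergence f
      (fun j => (hf.sub (hF j)).pos_part.aestronglyMeasurable) hf
      (fun j => .of_forall fun x => ?_) ?_
    · rw [Real.norm_of_nonneg (le_max_right _ _)]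
      exact max_le (by linarith [hF0 j x]) (hf0 x)
    · filter_upwards [hlim] with x hx
      simpa using (hx.const_sub (f x)).max (tendsto_const_nhds (x := (0 : ℝ)))
  simpa using h0.const_mul 2

theorem tendsto_integral_abs_mollify_sub {n : ℕ} {ρ : ℕ → ContDiffBump (0 : En n)} {K : ℝ}
    (hρ : Tendsto (fun j => (ρ j).rOut) atTop (𝓝 0))
    (hK : ∀ᶠ j in atTop, (ρ j).rOut ≤ K * (ρ j).rIn) {w : En n → ℝ} (hw : Integrable w) :
    Tendsto (fun j => ∫ x, |mollify (ρ j) w x - w x|) atTop (𝓝 0) := by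
  have nonneg_case : ∀ v : En n → ℝ, Integrable v → (∀ x, 0 ≤ v x) →
      Tendsto (fun j => ∫ x, |mollify (ρ j) v x - v x|) atTop (𝓝 0) := by
    intro v hv hv0
    refine tendsto_integral_abs_sub_of_nonneg (fun j => integrable_mollify _ hv) hv
      (fun j x => ?_) hv0 (fun j => integral_mollify _ hv)
      (ContDiffBump.ae_convolution_tendsto_right_of_locallyIntegrable hρ hK hv.locallyIntegrable)
    rw [mollify_apply]
    exact integral_nonneg fun t => mul_nonneg ((ρ j).nonneg_normed t) (hv0 _)
  have hp := nonneg_case _ hw.pos_part fun x => le_max_right _ _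
  have hm := nonneg_case _ hw.neg_part fun x => le_max_right _ _
  have hsum := hp.add hm
  rw [add_zero] at hsum
  refine squeeze_zero (fun j => integral_nonneg fun x => abs_nonneg _) (fun j => ?_) hsum
  have ip := ((integrable_mollify (ρ j) hw.pos_part).sub hw.pos_part).abs
  have im := ((integrable_mollify (ρ j) hw.neg_part).sub hw.neg_part).abs
  have hdec : ∀ x, w x = max (w x) 0 - max (-w x) 0 := fun x => by
    rcases le_total 0 (w x) with h | h
    · rw [max_eq_left h, max_eq_right (by linarith)]; ring
    · rw [max_eq_right h, max_eq_left (by linarith)]; ring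
  have hmoll : ∀ x, mollify (ρ j) w x
      = mollify (ρ j) (fun y => max (w y) 0) x - mollify (ρ j) (fun y => max (-w y) 0) x := by
    intro x
    rw [← mollify_sub _ hw.pos_part.locallyIntegrable hw.neg_part.locallyIntegrable]
    simp only [← hdec]
  refine (integral_mono ((integrable_mollify (ρ j) hw).sub hw).abs (ip.add im)
    fun x => ?_).trans_eq (integral_add ip im)
  simp only [Pi.add_apply, Pi.sub_apply]
  rw [hmoll x]
  calc _ = |(mollify (ρ j) (fun y => max (w y) 0) x - max (w x) 0)
          - (mollify (ρ j) (fun y => max (-w y) 0) x - max (-w x) 0)| := by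
        congr 1; linarith [hdec x]
    _ ≤ _ := abs_sub _ _

/-- The mollification of a weakly differentiable function has as gradient the mollification of
the weak gradient. -/
theorem HasWeakGradient.fderiv_mollify {n : ℕ} {u : En n → ℝ} {Du : En n → En n}
    (h : HasWeakGradient u Du) (ρ : ContDiffBump (0 : En n)) (x : En n) (i : Fin n) :
    fderiv ℝ (mollify ρ u) x (EuclideanSpace.single i 1) = mollify ρ (fun y => Du y i) x := by
  obtain ⟨hu, -, hweak⟩ := h
  have hsm : ContDiff ℝ 1 (ρ.normed volume) := ρ.contDiff_normed (n := 1)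
  have hd := ρ.hasCompactSupport_normed.hasFDerivAt_convolution_left
    (ContinuousLinearMap.lsmul ℝ ℝ) hsm hu x
  have hint : Integrable fun t => ((ContinuousLinearMap.lsmul ℝ ℝ).precompL (En n))
      (fderiv ℝ (ρ.normed volume) (x - t)) (u t) :=
    ((ρ.hasCompactSupport_normed.fderiv ℝ).convolutionExists_left _
      (hsm.continuous_fderiv one_ne_zero) hu x).integrable_swap
  unfold mollify at *
  rw [hd.fderiv, convolution_eq_swap, ContinuousLinearMap.integral_apply hint]
  have hφ : ContDiff ℝ (⊤ : ℕ∞) fun t => ρ.normed volume (x - t) :=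
    (ρ.contDiff_normed (n := ⊤)).comp (contDiff_const.sub contDiff_id)
  have hφc : HasCompactSupport fun t => ρ.normed volume (x - t) :=
    ρ.hasCompactSupport_normed.comp_homeomorph (Homeomorph.subLeft x)
  have hfd : ∀ t, fderiv ℝ (fun t => ρ.normed volume (x - t)) t (EuclideanSpace.single i 1)
      = - fderiv ℝ (ρ.normed volume) (x - t) (EuclideanSpace.single i 1) := by
    intro t
    have := ((hsm.differentiable one_ne_zero (x - t)).hasFDerivAt.comp t
      ((hasFDerivAt_id t).const_sub x)).fderiv
    simp only [Function.comp_def] at this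
    simp [this]
  have := hweak _ hφ hφc i
  simp only [hfd, mul_neg, integral_neg, neg_inj] at this
  rw [convolution_eq_swap]
  simp only [ContinuousLinearMap.lsmul_apply, smul_eq_mul]
  simp only [mul_comm (ρ.normed volume _)]
  rw [← this]
  refine integral_congr_ae (.of_forall fun t => ?_)
  simp [ContinuousLinearMap.precompL_apply, mul_comm]


theorem HasWeakGradient.locallyIntegrable_apply {n : ℕ} {u : En n → ℝ} {Du : En n → En n}
    (h : HasWeakGradient u Du) (i : Fin n) : LocallyIntegrable fun x => Du x i :=
  h.2.1.mono ((EuclideanSpace.proj (𝕜 := ℝ) i).continuous.comp_aestronglyMeasurable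
    h.2.1.aestronglyMeasurable) (.of_forall fun x => PiLp.norm_apply_le (Du x) i)

/-- Chain rule for weak gradients, in integrated form, for a bounded outer function with bounded
continuous derivative. -/
theorem HasWeakGradient.integral_comp_mul_fderiv {n : ℕ} {u : En n → ℝ} {Du : En n → En n}
    (h : HasWeakGradient u Du) {f f' : ℝ → ℝ} {C C' : ℝ} (hf : ∀ s, HasDerivAt f (f' s) s)
    (hf' : Continuous f') (hC : ∀ s, |f s| ≤ C) (hC' : ∀ s, |f' s| ≤ C') {φ : En n → ℝ}
    (hφ : ContDiff ℝ (⊤ : ℕ∞) φ) (hφc : HasCompactSupport φ) (i : Fin n) :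
    ∫ x, f (u x) * fderiv ℝ φ x (EuclideanSpace.single i 1)
      = - ∫ x, f' (u x) * Du x i * φ x := by
  have hu := h.1
  have hfc : Continuous f := continuous_iff_continuousAt.2 fun s => (hf s).continuousAt
  have hw : LocallyIntegrable fun x => Du x i := h.locallyIntegrable_apply i
  set e : En n := EuclideanSpace.single i 1 with he
  obtain ⟨ρ, hρ, hK⟩ : ∃ ρ : ℕ → ContDiffBump (0 : En n),
      Tendsto (fun j => (ρ j).rOut) atTop (𝓝 0) ∧
      ∀ᶠ j in atTop, (ρ j).rOut ≤ 2 * (ρ j).rIn := by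
    refine ⟨fun j => ⟨1 / ((j : ℝ) + 1), 2 * (1 / ((j : ℝ) + 1)), by positivity, ?_⟩,
      ?_, .of_forall fun j => le_rfl⟩
    · have : (0 : ℝ) < 1 / ((j : ℝ) + 1) := by positivity
      linarith
    · simpa using (tendsto_one_div_add_atTop_nhds_zero_nat (𝕜 := ℝ)).const_mul 2
  have hφ1 : ContDiff ℝ 1 φ := hφ.of_le (by exact_mod_cast le_top)
  have hdφ : Continuous fun x => fderiv ℝ φ x e :=
    (hφ1.continuous_fderiv one_ne_zero).clm_apply continuous_const
  have hdφc : HasCompactSupport fun x => fderiv ℝ φ x e := hφc.fderiv_apply ℝ e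
  obtain ⟨M, hM⟩ := hφc.exists_bound_of_continuous hφ.continuous
  have hM0 : 0 ≤ M := (norm_nonneg _).trans (hM 0)
  have hC'0 : 0 ≤ C' := (abs_nonneg _).trans (hC' 0)
  have hae : ∀ᵐ x, Tendsto (fun j => mollify (ρ j) u x) atTop (𝓝 (u x)) :=
    ContDiffBump.ae_convolution_tendsto_right_of_locallyIntegrable hρ hK hu
  have hmc : ∀ j, Continuous (mollify (ρ j) u) := fun j => (contDiff_mollify _ hu).continuous
  set K : Set (En n) := Metric.cthickening 1 (tsupport φ) with hKdef
  have hKc : IsCompact K := hφc.isCompact.cthickening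
  set w : En n → ℝ := K.indicator fun x => Du x i with hwdef
  have hwint : Integrable w :=
    (hw.integrableOn_isCompact hKc).integrable_indicator hKc.measurableSet
  have hloc : ∀ᶠ j in atTop, ∀ x ∈ tsupport φ,
      mollify (ρ j) (fun y => Du y i) x = mollify (ρ j) w x := by
    filter_upwards [hρ.eventually (gt_mem_nhds one_pos)] with j hj x hx
    refine mollify_congr_of_eqOn_ball _ fun y hy => ?_
    rw [hwdef, indicator_of_mem]
    exact Metric.mem_cthickening_of_dist_le y x 1 _ hx ((Metric.mem_ball.1 hy).le.trans hj.le)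
  have hsmooth : ∀ᶠ j in atTop, ∫ x, f (mollify (ρ j) u x) * fderiv ℝ φ x e
      = - ∫ x, (f' (mollify (ρ j) u x) * φ x) * mollify (ρ j) w x := by
    filter_upwards [hloc] with j hj
    have hd : ∀ x, DifferentiableAt ℝ (mollify (ρ j) u) x :=
      fun x => (contDiff_mollify _ hu).differentiable one_ne_zero x
    have hfd : ∀ x, fderiv ℝ (fun y => f (mollify (ρ j) u y)) x e
        = f' (mollify (ρ j) u x) * mollify (ρ j) (fun y => Du y i) x := by
      intro x
      have := ((hf (mollify (ρ j) u x)).comp_hasFDerivAt x (hd x).hasFDerivAt).fderiv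
      simp only [Function.comp_def] at this
      rw [this, ← h.fderiv_mollify (ρ j) x i]
      simp [he]
    have hcont : Continuous fun x => f (mollify (ρ j) u x) := hfc.comp (hmc j)
    have hcont' : Continuous fun x => f' (mollify (ρ j) u x) * mollify (ρ j) (fun y => Du y i) x :=
      (hf'.comp (hmc j)).mul (contDiff_mollify _ hw).continuous
    rw [integral_mul_fderiv_eq_neg_fderiv_mul_of_integrable]
    · congr 1
      refine integral_congr_ae (.of_forall fun x => ?_)
      simp only [hfd]
      by_cases hx : x ∈ tsupport φ
      · rw [hj x hx]; ring
      · simp [image_eq_zero_of_notMem_tsupport hx]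
    · simp only [hfd]
      exact (hcont'.mul hφ.continuous).integrable_of_hasCompactSupport hφc.mul_left
    · exact (hcont.mul hdφ).integrable_of_hasCompactSupport hdφc.mul_left
    · exact (hcont.mul hφ.continuous).integrable_of_hasCompactSupport hφc.mul_left
    · exact fun x _ => ((hf _).comp_hasFDerivAt x (hd x).hasFDerivAt).differentiableAt
    · exact fun x _ => hφ1.differentiable one_ne_zero x
  have hlhs : Tendsto (fun j => ∫ x, f (mollify (ρ j) u x) * fderiv ℝ φ x e) atTop
      (𝓝 (∫ x, f (u x) * fderiv ℝ φ x e)) := by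
    refine tendsto_integral_of_dominated_convergence (fun x => C * |fderiv ℝ φ x e|)
      (fun j => ((hfc.comp (hmc j)).mul hdφ).aestronglyMeasurable)
      ((hdφ.integrable_of_hasCompactSupport hdφc).abs.const_mul C)
      (fun j => .of_forall fun x => ?_) ?_
    · rw [norm_mul]
      exact mul_le_mul_of_nonneg_right (hC _) (abs_nonneg _)
    · filter_upwards [hae] with x hx
      exact ((hfc.tendsto _).comp hx).mul_const _
  have hbound : ∀ s x, |f' s * φ x| ≤ C' * M := fun s x => by
    rw [abs_mul]
    exact mul_le_mul (hC' s) (hM x) (abs_nonneg _) hC'0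
  have hcoef : ∀ j, Continuous fun x => f' (mollify (ρ j) u x) * φ x :=
    fun j => (hf'.comp (hmc j)).mul hφ.continuous
  have hmain : Tendsto (fun j => ∫ x, (f' (mollify (ρ j) u x) * φ x) * w x) atTop
      (𝓝 (∫ x, (f' (u x) * φ x) * w x)) := by
    refine tendsto_integral_of_dominated_convergence (fun x => C' * M * |w x|)
      (fun j => (hcoef j).aestronglyMeasurable.mul hwint.aestronglyMeasurable)
      (hwint.abs.const_mul _) (fun j => .of_forall fun x => ?_) ?_
    · rw [norm_mul]
      exact mul_le_mul_of_nonneg_right (hbound _ _) (abs_nonneg _)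
    · filter_upwards [hae] with x hx
      exact (((hf'.tendsto _).comp hx).mul_const _).mul_const _
  have herr : Tendsto (fun j => ∫ x, (f' (mollify (ρ j) u x) * φ x) * (mollify (ρ j) w x - w x))
      atTop (𝓝 0) := by
    have hL1 := (tendsto_integral_abs_mollify_sub hρ hK hwint).const_mul (C' * M)
    rw [mul_zero] at hL1
    refine squeeze_zero_norm (fun j => ?_) hL1
    rw [← integral_const_mul]
    refine norm_integral_le_of_norm_le
      (((integrable_mollify (ρ j) hwint).sub hwint).abs.const_mul _) (.of_forall fun x => ?_)
    rw [norm_mul]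
    exact mul_le_mul_of_nonneg_right (hbound _ _) (abs_nonneg _)
  have hrhs : Tendsto (fun j => ∫ x, (f' (mollify (ρ j) u x) * φ x) * mollify (ρ j) w x) atTop
      (𝓝 (∫ x, (f' (u x) * φ x) * w x)) := by
    have hsum := herr.add hmain
    rw [zero_add] at hsum
    refine hsum.congr fun j => ?_
    have i1 : Integrable fun x =>
        (f' (mollify (ρ j) u x) * φ x) * (mollify (ρ j) w x - w x) :=
      ((integrable_mollify (ρ j) hwint).sub hwint).bdd_mul (hcoef j).aestronglyMeasurable
        (.of_forall fun x => hbound _ x)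
    have i2 : Integrable fun x => (f' (mollify (ρ j) u x) * φ x) * w x :=
      hwint.bdd_mul (hcoef j).aestronglyMeasurable (.of_forall fun x => hbound _ x)
    rw [← integral_add i1 i2]
    exact integral_congr_ae (.of_forall fun x => by ring)
  rw [tendsto_nhds_unique (hlhs.congr' hsmooth) hrhs.neg]
  congr 1
  refine integral_congr_ae (.of_forall fun x => ?_)
  by_cases hx : x ∈ tsupport φ
  · have : x ∈ K := Metric.self_subset_cthickening _ hx
    simp only [hwdef, indicator_of_mem this]; ring
  · simp [image_eq_zero_of_notMem_tsupport hx]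

theorem HasWeakGradient.congr_ae {n : ℕ} {u v : En n → ℝ} {Du : En n → En n}
    (h : HasWeakGradient u Du) (huv : u =ᵐ[volume] v) : HasWeakGradient v Du := by
  refine ⟨h.1.congr huv, h.2.1, fun φ hφ hφc i => ?_⟩
  rw [← h.2.2 φ hφ hφc i]
  refine integral_congr_ae ?_
  filter_upwards [huv] with x hx
  rw [hx]

/-- Truncation of a real number to the interval `[0, lam]`. -/
def clamp (lam s : ℝ) : ℝ := max 0 (min s lam)

/-- A continuous approximation of the indicator function of `(0, lam)`. -/
def plateau (lam : ℝ) (k : ℕ) (t : ℝ) : ℝ := min 1 (k * max 0 (min t (lam - t)))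

theorem continuous_plateau (lam : ℝ) (k : ℕ) : Continuous (plateau lam k) := by
  unfold plateau; fun_prop

theorem plateau_nonneg (lam : ℝ) (k : ℕ) (t : ℝ) : 0 ≤ plateau lam k t := by
  unfold plateau; positivity

theorem plateau_le_one (lam : ℝ) (k : ℕ) (t : ℝ) : plateau lam k t ≤ 1 := min_le_left _ _

theorem abs_plateau_le_one (lam : ℝ) (k : ℕ) (t : ℝ) : |plateau lam k t| ≤ 1 := by
  rw [abs_of_nonneg (plateau_nonneg _ _ _)]; exact plateau_le_one _ _ _

theorem plateau_eq_zero {lam : ℝ} (k : ℕ) {t : ℝ} (ht : t ∉ Ioo 0 lam) : plateau lam k t = 0 := by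
  have : min t (lam - t) ≤ 0 := by
    by_contra! h
    rw [lt_min_iff] at h
    exact ht ⟨h.1, by linarith [h.2]⟩
  simp [plateau, max_eq_left this]

theorem tendsto_plateau (lam t : ℝ) :
    Tendsto (fun k => plateau lam k t) atTop (𝓝 ((Ioo 0 lam).indicator 1 t)) := by
  by_cases ht : t ∈ Ioo 0 lam
  · rw [indicator_of_mem ht]
    have hpos : 0 < max 0 (min t (lam - t)) :=
      lt_max_of_lt_right (lt_min ht.1 (by linarith [ht.2]))
    have := (tendsto_natCast_atTop_atTop (R := ℝ)).atTop_mul_const hpos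
    refine tendsto_const_nhds.congr' ?_
    filter_upwards [this.eventually_ge_atTop 1] with k hk
    exact (min_eq_left hk).symm
  · rw [indicator_of_notMem ht]
    simp only [plateau_eq_zero _ ht, tendsto_const_nhds]

theorem integrable_plateau (lam : ℝ) (k : ℕ) : Integrable (plateau lam k) :=
  (continuous_plateau lam k).integrable_of_hasCompactSupport <|
    HasCompactSupport.intro (isCompact_Icc (a := 0) (b := lam)) fun _ ht =>
      plateau_eq_zero k fun h => ht (Ioo_subset_Icc_self h)

theorem integral_indicator_Ioo_eq_clamp {lam : ℝ} (hlam : 0 < lam) (s : ℝ) :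
    ∫ t in (0 : ℝ)..s, (Ioo 0 lam).indicator (1 : ℝ → ℝ) t = clamp lam s := by
  unfold clamp
  rcases le_total s 0 with hs | hs
  · rw [max_eq_left ((min_le_left _ _).trans hs)]
    refine intervalIntegral.integral_zero_ae (.of_forall fun t ht => ?_)
    rw [uIoc_of_ge hs] at ht
    exact indicator_of_notMem (fun h => h.1.not_ge ht.2) _
  · rw [max_eq_right (le_min hs hlam.le), intervalIntegral.integral_of_le hs,
      integral_indicator_one measurableSet_Ioo, measureReal_restrict_apply measurableSet_Ioo]
    rcases lt_or_ge s lam with h | h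
    · have : Ioo 0 lam ∩ Ioc 0 s = Ioc 0 s :=
        inter_eq_right.2 fun t ht => ⟨ht.1, ht.2.trans_lt h⟩
      rw [this, min_eq_left h.le]; simp [hs]
    · have : Ioo 0 lam ∩ Ioc 0 s = Ioo 0 lam :=
        inter_eq_left.2 fun t ht => ⟨ht.1, ht.2.le.trans h⟩
      rw [this, min_eq_right h]; simp [hlam.le]

/-- The truncation of a weakly differentiable function is weakly differentiable. -/
theorem HasWeakGradient.clamp {n : ℕ} {u : En n → ℝ} {Du : En n → En n} {lam : ℝ}
    (h : HasWeakGradient u Du) (hlam : 0 < lam) (hum : Measurable u) :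
    HasWeakGradient (fun x => clamp lam (u x)) ((u ⁻¹' Ioo 0 lam).indicator Du) := by
  have hw := h.locallyIntegrable_apply
  have hcm : Measurable fun x => _root_.clamp lam (u x) :=
    measurable_const.max (hum.min measurable_const)
  refine ⟨h.1.mono hcm.aestronglyMeasurable (.of_forall fun x => ?_),
    h.2.1.indicator (hum measurableSet_Ioo), fun φ hφ hφc i => ?_⟩
  · rw [Real.norm_eq_abs, Real.norm_eq_abs, _root_.clamp, abs_of_nonneg (le_max_left _ _)]
    exact max_le (abs_nonneg _) ((min_le_left _ _).trans (le_abs_self _))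
  set f : ℕ → ℝ → ℝ := fun k s => ∫ t in (0 : ℝ)..s, plateau lam k t with hfdef
  have hfd : ∀ k s, HasDerivAt (f k) (plateau lam k s) s := fun k s =>
    (continuous_plateau lam k).integral_hasStrictDerivAt 0 s |>.hasDerivAt
  have hfc : ∀ k, Continuous (f k) := fun k =>
    continuous_iff_continuousAt.2 fun s => (hfd k s).continuousAt
  have hfC : ∀ k s, |f k s| ≤ ∫ t, |plateau lam k t| := fun k s => by
    have := intervalIntegral.norm_integral_le_integral_norm_uIoc (f := plateau lam k)
      (a := 0) (b := s) (μ := volume)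
    exact this.trans <| setIntegral_le_integral (integrable_plateau lam k).abs
      (.of_forall fun t => abs_nonneg _)
  have hf_abs : ∀ k s, |f k s| ≤ |s| := fun k s => by
    have := intervalIntegral.norm_integral_le_of_norm_le_const (a := 0) (b := s)
      (f := plateau lam k) (C := 1) fun t _ => abs_plateau_le_one lam k t
    simpa using this
  have hflim : ∀ s, Tendsto (fun k => f k s) atTop (𝓝 (_root_.clamp lam s)) := fun s => by
    rw [← integral_indicator_Ioo_eq_clamp hlam]
    refine intervalIntegral.tendsto_integral_filter_of_dominated_convergence (fun _ => 1)
      (.of_forall fun k => (continuous_plateau lam k).aestronglyMeasurable)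
      (.of_forall fun k => .of_forall fun t _ => abs_plateau_le_one lam k t)
      intervalIntegrable_const (.of_forall fun t _ => tendsto_plateau lam t)
  have hφ1 : ContDiff ℝ 1 φ := hφ.of_le (by exact_mod_cast le_top)
  have hdφ : Continuous fun x => fderiv ℝ φ x (EuclideanSpace.single i (1 : ℝ)) :=
    (hφ1.continuous_fderiv one_ne_zero).clm_apply continuous_const
  have hdφc : HasCompactSupport fun x => fderiv ℝ φ x (EuclideanSpace.single i (1 : ℝ)) :=
    hφc.fderiv_apply ℝ _
  have hlhs : Tendsto (fun k => ∫ x, f k (u x) * fderiv ℝ φ x (EuclideanSpace.single i 1)) atTop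
      (𝓝 (∫ x, _root_.clamp lam (u x) * fderiv ℝ φ x (EuclideanSpace.single i 1))) := by
    refine tendsto_integral_of_dominated_convergence
      (fun x => |u x * fderiv ℝ φ x (EuclideanSpace.single i 1)|)
      (fun k => ((hfc k).measurable.comp hum).aestronglyMeasurable.mul hdφ.aestronglyMeasurable)
      (h.1.integrable_smul_right_of_hasCompactSupport hdφ hdφc).abs
      (fun k => .of_forall fun x => ?_) (.of_forall fun x => (hflim _).mul_const _)
    rw [norm_mul, abs_mul]
    exact mul_le_mul_of_nonneg_right (hf_abs _ _) (abs_nonneg _)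
  have hrhs : Tendsto (fun k => ∫ x, plateau lam k (u x) * Du x i * φ x) atTop
      (𝓝 (∫ x, (u ⁻¹' Ioo 0 lam).indicator Du x i * φ x)) := by
    refine tendsto_integral_of_dominated_convergence (fun x => |Du x i * φ x|)
      (fun k => ((((continuous_plateau lam k).measurable.comp hum).aestronglyMeasurable.mul
        (hw i).aestronglyMeasurable).mul hφ.continuous.aestronglyMeasurable))
      ((hw i).integrable_smul_right_of_hasCompactSupport hφ.continuous hφc).abs
      (fun k => .of_forall fun x => ?_) (.of_forall fun x => ?_)
    · rw [mul_assoc, norm_mul]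
      exact mul_le_of_le_one_left (abs_nonneg _) (abs_plateau_le_one _ _ _)
    · have : (u ⁻¹' Ioo 0 lam).indicator Du x i = (Ioo 0 lam).indicator 1 (u x) * Du x i := by
        by_cases hx : u x ∈ Ioo 0 lam
        · rw [indicator_of_mem (show x ∈ u ⁻¹' Ioo 0 lam from hx), indicator_of_mem hx]; simp
        · rw [indicator_of_notMem (show x ∉ u ⁻¹' Ioo 0 lam from hx), indicator_of_notMem hx]; simp
      rw [this]
      exact ((tendsto_plateau lam (u x)).mul_const _).mul_const _
  refine tendsto_nhds_unique hlhs (hrhs.neg.congr fun k => ?_)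
  exact (h.integral_comp_mul_fderiv (hfd k) (continuous_plateau lam k) (hfC k)
    (abs_plateau_le_one lam k) hφ hφc i).symm

/-- Every competitor for the capacity can be replaced by a Borel one with values in `[0, lam]`. -/
theorem exists_measurable_bounded_competitor {n : ℕ} {Φ : En n → En n → ℝ≥0∞}
    (hΦ0 : ∀ x, Φ x 0 = 0) {A B : Set (En n)} (hA : MeasurableSet A) (hB : MeasurableSet B)
    (hAB : A ⊆ B) {lam : ℝ} (hlam : 0 < lam) {u : En n → ℝ} {Du : En n → En n}
    (h : HasWeakGradient u Du) (huA : ∀ x ∈ A, u x = lam) (huB : ∀ x ∉ B, u x = 0) :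
    ∃ (v : En n → ℝ) (Dv : En n → En n), Measurable v ∧ (∀ x, v x ∈ Icc 0 lam) ∧
      HasWeakGradient v Dv ∧ (∀ x ∈ A, v x = lam) ∧ (∀ x ∉ B, v x = 0) ∧
      ∫⁻ x, Φ x (Dv x) ≤ ∫⁻ x, Φ x (Du x) := by
  classical
  have hum := h.1.aestronglyMeasurable
  set g : En n → ℝ := A.piecewise (fun _ => lam) (B.piecewise (hum.mk u) fun _ => 0) with hg
  have hgm : Measurable g := measurable_const.piecewise hA
    (hum.stronglyMeasurable_mk.measurable.piecewise hB measurable_const)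
  have hgA : ∀ x ∈ A, g x = lam := fun x hx => by simp [hg, hx]
  have hgB : ∀ x ∉ B, g x = 0 := fun x hx => by
    have hxA : x ∉ A := fun hxA => hx (hAB hxA)
    simp [hg, hx, hxA]
  have hug : u =ᵐ[volume] g := by
    filter_upwards [hum.ae_eq_mk] with x hx
    by_cases hxA : x ∈ A
    · rw [huA x hxA, hgA x hxA]
    by_cases hxB : x ∈ B
    · simp [hg, hxA, hxB, hx]
    · rw [huB x hxB, hgB x hxB]
  refine ⟨fun x => clamp lam (g x), (g ⁻¹' Ioo 0 lam).indicator Du,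
    measurable_const.max (hgm.min measurable_const),
    fun x => ⟨le_max_left _ _, max_le hlam.le (min_le_right _ _)⟩,
    (h.congr_ae hug).clamp hlam hgm, fun x hx => ?_, fun x hx => ?_, lintegral_mono fun x => ?_⟩
  · simp [clamp, hgA x hx, hlam.le]
  · simp [clamp, hgB x hx, hlam.le]
  · by_cases hx : x ∈ g ⁻¹' Ioo 0 lam
    · simp [indicator_of_mem hx]
    · simp [indicator_of_notMem hx, hΦ0]

theorem SetRearrangement.setMap_mono {n : ℕ} (R : SetRearrangement n) {A B : Set (En n)}
    (hA : MeasurableSet A) (hB : MeasurableSet B) (hAB : A ⊆ B) : R.setMap A ⊆ R.setMap B := by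
  classical
  let w : En n → EReal := A.piecewise (fun _ => ((2 : ℝ) : EReal))
    (B.piecewise (fun _ => ((1 : ℝ) : EReal)) fun _ => ((0 : ℝ) : EReal))
  have hw : Measurable w :=
    measurable_const.piecewise hA (measurable_const.piecewise hB measurable_const)
  have hwA : {x | ((1 : ℝ) : EReal) < w x} = A := by
    ext x
    by_cases hxA : x ∈ A
    · have h12 : (1 : EReal) < ((2 : ℝ) : EReal) := by exact_mod_cast one_lt_two (α := ℝ)
      simpa [w, hxA] using h12
    by_cases hxB : x ∈ B <;> simp [w, hxA, hxB]
  have hwB : {x | ((0 : ℝ) : EReal) < w x} = B := by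
    ext x
    by_cases hxA : x ∈ A
    · simp [w, hxA, hAB hxA]
    by_cases hxB : x ∈ B <;> simp [w, hxA, hxB]
  have h1 := R.levelSet_fnMap w hw 1
  have h0 := R.levelSet_fnMap w hw 0
  rw [hwA] at h1
  rw [hwB] at h0
  rw [← h1, ← h0]
  exact fun y hy => (EReal.coe_lt_coe_iff.2 one_pos).trans hy

/-- necessary condition for the Pólya–Szegő inequality. -/
theorem statement9 {n : ℕ} (R : SetRearrangement n)
    (Φ Ψ : En n → En n → ℝ≥0∞)
    (hΦmeas : Measurable (Function.uncurry Φ)) (hΨmeas : Measurable (Function.uncurry Ψ))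
    (hΦ0 : ∀ x, Φ x 0 = 0) (hΨ0 : ∀ y, Ψ y 0 = 0)
    (hPS : ∀ (u : En n → ℝ) (Du : En n → En n), Measurable u →
      (∃ C : ℝ, ∀ x, |u x| ≤ C) → HasWeakGradient u Du → ∫⁻ x, Φ x (Du x) < ⊤ →
      ∃ (v : En n → ℝ) (Dv : En n → En n),
        (∀ y, R.fnMap (fun x => (u x : EReal)) y = (v y : EReal)) ∧
        HasWeakGradient v Dv ∧
        ∫⁻ y, Ψ y (Dv y) ≤ ∫⁻ x, Φ x (Du x)) :
    ∀ A B : Set (En n), MeasurableSet A → MeasurableSet B → A ⊆ B →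
      ∀ lam : ℝ, 0 < lam →
        capaGen Ψ lam (R.setMap A) (R.setMap B) ≤ capaGen Φ lam A B := by
  intro A B hA hB hAB lam hlam
  refine le_iInf fun u => le_iInf fun Du => le_iInf fun hu => le_iInf fun huA =>
    le_iInf fun huB => ?_
  obtain ⟨v, Dv, hvm, hv01, hv, hvA, hvB, hle⟩ :=
    exists_measurable_bounded_competitor hΦ0 hA hB hAB hlam hu huA huB
  refine le_trans ?_ hle
  rcases eq_or_ne (∫⁻ x, Φ x (Dv x)) ⊤ with htop | hfin
  · rw [htop]; exact le_top
  obtain ⟨w, Dw, hvw, hw, hwle⟩ := hPS v Dv hvm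
    ⟨lam, fun x => abs_le.2 ⟨by linarith [(hv01 x).1], (hv01 x).2⟩⟩ hv hfin.lt_top
  have hlevel : ∀ (y : En n) (t : ℝ), t < w y ↔ y ∈ R.setMap {x | t < v x} := by
    intro y t
    have := Set.ext_iff.1 (R.levelSet_fnMap (fun x => (v x : EReal))
      (measurable_coe_real_ereal.comp hvm) t) y
    simpa only [mem_ofPred_eq, hvw, EReal.coe_lt_coe_iff] using this
  have hw_le : ∀ y, w y ≤ lam := by
    intro y
    by_contra! hy
    have hempty : {x | lam < v x} = ∅ := eq_empty_of_forall_notMem fun x hx => (hv01 x).2.not_gt hx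
    rw [hlevel, hempty, R.setMap_empty] at hy
    exact hy
  have hw_nonneg : ∀ y, 0 ≤ w y := by
    refine fun y => le_of_forall_lt fun t ht => ?_
    have huniv : {x | t < v x} = univ := eq_univ_of_forall fun x => ht.trans_le (hv01 x).1
    rw [hlevel, huniv, R.setMap_univ]
    trivial
  refine le_trans ?_ hwle
  refine iInf_le_of_le w <| iInf_le_of_le Dw <| iInf_le_of_le hw <|
    iInf_le_of_le (fun y hy => le_antisymm (hw_le y) (le_of_forall_lt fun t ht => ?_)) <|
    iInf_le_of_le (fun y hy => le_antisymm ?_ (hw_nonneg y)) le_rfl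
  · rw [hlevel]
    exact R.setMap_mono hA (measurableSet_lt measurable_const hvm)
      (fun x hx => ht.trans_eq (hvA x hx).symm) hy
  · by_contra! hpos
    rw [hlevel] at hpos
    refine hy (R.setMap_mono (measurableSet_lt measurable_const hvm) hB (fun x hx => ?_) hpos)
    by_contra hxB
    exact ne_of_gt (show 0 < v x from hx) (hvB x hxB)
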